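/- Let G be a gyrogroup and let S ⊆ G be a subset such that gyr[g,s] is the identity map on G for every g ∈ G and every s ∈ S. Then for all g, z ∈ G and all s ∈ S, (s ⊕ z) ⊕ g = s ⊕ (z ⊕ g); consequently, for every g ∈ G the right-addition map x ↦ x ⊕ g preserves adjacency in the left Cayley graph LCay(G,S). -/

import Mathlib

/-- A gyrogroup: a set `G` with a binary operation `add` (⊕), an identity `e`,
an inverse operation `neg` (⊖), and for each pair `a b : G` a gyroautomorphism
`gyr a b : G → G`, satisfying the gyrogroup axioms. -/
class Gyrogroup (G : Type*) where
  add : G → G → G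
  e : G
  neg : G → G
  gyr : G → G → G → G
  e_add : ∀ x, add e x = x
  add_e : ∀ x, add x e = x
  neg_add : ∀ x, add (neg x) x = e
  add_neg : ∀ x, add x (neg x) = e
  gyr_bijective : ∀ a b, Function.Bijective (gyr a b)
  gyr_add : ∀ a b x y, gyr a b (add x y) = add (gyr a b x) (gyr a b y)
  left_gyroassoc : ∀ a b c, add a (add b c) = add (add a b) (gyr a b c)
  left_loop : ∀ a b, gyr (add a b) b = gyr a b

open Gyrogroup


namespace Gyrogroup

variable {G : Type*} [Gyrogroup G]

theorem add_left_injective (a : G) : Function.Injective (add a) := by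
  intro b c h
  have h' : add (neg a) (add a b) = add (neg a) (add a c) := congrArg _ h
  rw [left_gyroassoc, left_gyroassoc, neg_add, e_add, e_add] at h'
  exact (gyr_bijective (neg a) a).injective h'

theorem gyr_e_left (a b : G) : gyr e a b = b := by
  have h := left_gyroassoc e a b
  rw [e_add, e_add] at h
  exact (add_left_injective a h).symm

theorem neg_add_cancel_left' (a b : G) : add (neg a) (add a b) = b := by
  rw [left_gyroassoc, ← left_loop, neg_add, e_add, gyr_e_left]

theorem add_neg_cancel_left' (a b : G) : add a (add (neg a) b) = b := by
  rw [left_gyroassoc, ← left_loop, add_neg, e_add, gyr_e_left]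

/-- The left Bol identity. -/
theorem left_bol (x y z : G) : add x (add y (add x z)) = add (add x (add y x)) z := by
  obtain ⟨c, hc⟩ : ∃ c, add (add y x) c = add y (add x z) :=
    ⟨_, add_neg_cancel_left' (add y x) _⟩
  have hgyr : gyr (neg y) (add y x) c = z := by
    apply add_left_injective x
    have h := left_gyroassoc (neg y) (add y x) c
    rw [hc, neg_add_cancel_left', neg_add_cancel_left'] at h
    exact h.symm
  have hloop := left_loop (neg y) (add y x)
  rw [neg_add_cancel_left'] at hloop
  rw [← hc, left_gyroassoc, hloop, hgyr]

theorem exists_add_eq (s z : G) : ∃ y, add y s = z :=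
  ⟨add (neg s) (add (add s z) (neg s)), by
    rw [← left_bol, neg_add, add_e, neg_add_cancel_left']⟩

/-- An element of the middle nucleus lies in the left nucleus. -/
theorem add_assoc_of_gyr_right_eq_id {s : G} (hs : ∀ g x : G, gyr g s x = x) (z g : G) :
    add (add s z) g = add s (add z g) := by
  obtain ⟨y, rfl⟩ := exists_add_eq s z
  have h := left_gyroassoc y s g
  rw [hs] at h
  rw [← h, left_bol]

end Gyrogroup

/-- If `gyr g s` is the identity for all `g ∈ G`, `s ∈ S`, then
`(s ⊕ z) ⊕ g = s ⊕ (z ⊕ g)`, and consequently right addition by any `g`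
preserves adjacency in the left Cayley graph `LCay(G,S)`. -/
theorem lcay_right_add_preserves_adj {G : Type*} [Gyrogroup G] (S : Set G)
    (hgyr : ∀ g : G, ∀ s ∈ S, ∀ x : G, gyr g s x = x) :
    (∀ g z : G, ∀ s ∈ S, add (add s z) g = add s (add z g)) ∧
      ∀ g u v : G, (∃ s ∈ S, v = add s u) →
        ∃ s ∈ S, add v g = add s (add u g) := by
  have hassoc : ∀ g z : G, ∀ s ∈ S, add (add s z) g = add s (add z g) := fun g z s hs =>
    add_assoc_of_gyr_right_eq_id (fun a => hgyr a s hs) z g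
  refine ⟨hassoc, ?_⟩
  rintro g u _ ⟨s, hs, rfl⟩
  exact ⟨s, hs, hassoc g u s hs⟩
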